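/- Every three-qubit pure state can be obtained from the three-dimensional GHZ state with probability 1: let |GHZ₃⟩ = (|000⟩ + |111⟩ + |222⟩)/√3 in ℂ³⊗ℂ³⊗ℂ³ (standard basis |0⟩,|1⟩,|2⟩ of ℂ³), and let ψ be any unit vector in ℂ³⊗ℂ³⊗ℂ³ lying in the subspace spanned by the basis vectors |xyz⟩ with x,y,z ∈ {0,1} (i.e., a tripartite pure three-qubit state). Then there exists a finite family of product operators O_i = A_i⊗B_i⊗C_i, with A_i, B_i, C_i linear maps on ℂ³, satisfying ∑_i O_i†O_i = 1 (identity on ℂ³⊗ℂ³⊗ℂ³) and such that every O_i|GHZ₃⟩ is a complex scalar multiple of ψ. -/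

import Mathlib

noncomputable section

open Matrix

/-- Tensor product of three vectors of `ℂ³`, realized inside
`EuclideanSpace ℂ (Fin 3 × Fin 3 × Fin 3)`. -/
def tp3 (a b c : EuclideanSpace ℂ (Fin 3)) : EuclideanSpace ℂ (Fin 3 × Fin 3 × Fin 3) :=
  (WithLp.equiv 2 _).symm fun p => a p.1 * b p.2.1 * c p.2.2

/-- The product operator `A ⊗ B ⊗ C` on `ℂ³⊗ℂ³⊗ℂ³`, as a matrix. -/
def kron3 (A B C : Matrix (Fin 3) (Fin 3) ℂ) :
    Matrix (Fin 3 × Fin 3 × Fin 3) (Fin 3 × Fin 3 × Fin 3) ℂ :=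
  fun p q => A p.1 q.1 * B p.2.1 q.2.1 * C p.2.2 q.2.2

/-- The computational basis vector `|i⟩` of `ℂ³`. -/
def ket (i : Fin 3) : EuclideanSpace ℂ (Fin 3) := EuclideanSpace.single i 1

/-- The three-dimensional GHZ state `(|000⟩ + |111⟩ + |222⟩)/√3`. -/
def GHZ3 : EuclideanSpace ℂ (Fin 3 × Fin 3 × Fin 3) :=
  (Real.sqrt 3 : ℂ)⁻¹ •
    (tp3 (ket 0) (ket 0) (ket 0) + tp3 (ket 1) (ket 1) (ket 1) + tp3 (ket 2) (ket 2) (ket 2))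

/-- **Singular value decomposition** of a complex square matrix. -/
theorem exists_unitary_mul_diagonal_mul_unitary {n : Type*} [Fintype n] [DecidableEq n]
    (N : Matrix n n ℂ) :
    ∃ U ∈ unitaryGroup n ℂ, ∃ V ∈ unitaryGroup n ℂ, ∃ d : n → ℂ, N = U * diagonal d * V := by
  have hH : (Nᴴ * N).IsHermitian := isHermitian_conjTranspose_mul_self N
  set W := hH.eigenvectorUnitary with hW
  set P : Matrix n n ℂ := N * (W : Matrix n n ℂ) with hP
  have hPP : Pᴴ * P = diagonal (RCLike.ofReal ∘ hH.eigenvalues) := by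
    have := hH.conjStarAlgAut_star_eigenvectorUnitary
    simp only [Unitary.conjStarAlgAut_apply] at this
    rw [← this, hP, conjTranspose_mul]
    simp [Matrix.mul_assoc, star_eq_conjTranspose, hW]
  let u : n → EuclideanSpace ℂ n := fun j => WithLp.toLp 2 (P.col j)
  have hu (i j : n) (hij : i ≠ j) : inner ℂ (u i) (u j) = 0 := by
    have := congrFun (congrFun hPP i) j
    rw [diagonal_apply_ne _ hij] at this
    rw [← this]
    simp [u, mul_apply, PiLp.inner_apply, mul_comm]
  let v : n → EuclideanSpace ℂ n := fun j => (‖u j‖ : ℂ)⁻¹ • u j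
  have hv : Orthonormal ℂ ({j | u j ≠ 0}.domRestrict v) := by
    constructor
    · rintro ⟨j, hj⟩
      have : ‖u j‖ ≠ 0 := norm_ne_zero_iff.mpr hj
      simp [Set.domRestrict_apply, v, norm_smul, this]
    · rintro ⟨i, hi⟩ ⟨j, hj⟩ hij
      simp [Set.domRestrict_apply, v, inner_smul_left, inner_smul_right,
        hu i j (by simpa using hij)]
  obtain ⟨b, hb⟩ := hv.exists_orthonormalBasis_extension_of_card_eq (by simp)
  have hub (j : n) : u j = (‖u j‖ : ℂ) • b j := by
    by_cases hj : u j = 0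
    · simp [hj]
    · have : (‖u j‖ : ℂ) ≠ 0 := by simpa using hj
      rw [hb j hj, smul_inv_smul₀ this]
  let U : Matrix n n ℂ := of fun i j => b j i
  have hU : U ∈ unitaryGroup n ℂ := by
    rw [mem_unitaryGroup_iff']
    ext i j
    have := orthonormal_iff_ite.mp b.orthonormal i j
    rw [one_apply, ← this]
    simp [U, mul_apply, star_apply, PiLp.inner_apply, mul_comm]
  refine ⟨U, hU, star (W : Matrix n n ℂ), Unitary.star_mem W.2, fun j => (‖u j‖ : ℂ), ?_⟩
  have hPU : P = U * diagonal fun j => (‖u j‖ : ℂ) := by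
    ext i j
    have := congrArg (fun w : EuclideanSpace ℂ n => w i) (hub j)
    simpa [u, U, mul_diagonal, mul_comm] using this
  rw [← hPU, hP, Matrix.mul_assoc, Unitary.mul_star_self_of_mem W.2, Matrix.mul_one]

theorem star_col_dotProduct_col_of_mem_unitaryGroup {n : Type*} [Fintype n] [DecidableEq n]
    {U : Matrix n n ℂ} (hU : U ∈ unitaryGroup n ℂ) (i j : n) :
    star (U.col i) ⬝ᵥ U.col j = (1 : Matrix n n ℂ) i j := by
  rw [← mem_unitaryGroup_iff'.mp hU]
  rfl

theorem star_row_dotProduct_row_of_mem_unitaryGroup {n : Type*} [Fintype n] [DecidableEq n]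
    {U : Matrix n n ℂ} (hU : U ∈ unitaryGroup n ℂ) (i j : n) :
    star (U.row i) ⬝ᵥ U.row j = (1 : Matrix n n ℂ) i j := by
  rw [← transpose_one, transpose_apply, ← mem_unitaryGroup_iff.mp hU, dotProduct_comm]
  rfl

/-- A singular complex matrix of size two is a multiple of a product of two unit vectors. -/
theorem exists_unit_vecMulVec_of_det_eq_zero {N : Matrix (Fin 2) (Fin 2) ℂ} (hN : N.det = 0) :
    ∃ (s : ℂ) (b c : Fin 2 → ℂ), star b ⬝ᵥ b = 1 ∧ star c ⬝ᵥ c = 1 ∧ N = s • vecMulVec b c := by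
  obtain ⟨U, hU, V, hV, d, rfl⟩ := exists_unitary_mul_diagonal_mul_unitary N
  have hUd : U.det ≠ 0 := (UnitaryGroup.det_isUnit ⟨U, hU⟩).ne_zero
  have hVd : V.det ≠ 0 := (UnitaryGroup.det_isUnit ⟨V, hV⟩).ne_zero
  have hd : d 0 = 0 ∨ d 1 = 0 := by
    simpa [hUd, hVd, Fin.prod_univ_two] using hN
  have key (i : Fin 2) (h : ∀ j, j ≠ i → d j = 0) :
      U * diagonal d * V = d i • vecMulVec (U.col i) (V.row i) := by
    ext j k
    rw [mul_apply, Finset.sum_eq_single i (fun l _ hl => by simp [mul_diagonal, h l hl]) (by simp)]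
    simp [mul_diagonal, vecMulVec_apply]
    ring
  have unit (i : Fin 2) : star (U.col i) ⬝ᵥ U.col i = 1 ∧ star (V.row i) ⬝ᵥ V.row i = 1 := by
    rw [star_col_dotProduct_col_of_mem_unitaryGroup hU,
      star_row_dotProduct_row_of_mem_unitaryGroup hV]
    simp
  rcases hd with h | h
  · exact ⟨d 1, _, _, (unit 1).1, (unit 1).2, key 1 fun j hj => by
      rwa [(by omega : j = 0)]⟩
  · exact ⟨d 0, _, _, (unit 0).1, (unit 0).2, key 0 fun j hj => by
      rwa [(by omega : j = 1)]⟩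

/-- Every pencil of complex square matrices of size two contains a singular matrix, at a unit
coefficient vector. -/
theorem exists_unit_det_pencil_eq_zero (M₀ M₁ : Matrix (Fin 2) (Fin 2) ℂ) :
    ∃ x y : ℂ, star x * x + star y * y = 1 ∧ (x • M₀ + y • M₁).det = 0 := by
  by_cases h : M₁.det = 0
  · exact ⟨0, 1, by simp, by simpa using h⟩
  obtain ⟨z, hz⟩ := IsAlgClosed.exists_eq_mul_self
    (discrim M₁.det (M₀ 0 0 * M₁ 1 1 + M₁ 0 0 * M₀ 1 1 - M₀ 0 1 * M₁ 1 0 - M₁ 0 1 * M₀ 1 0) M₀.det)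
  obtain ⟨y, hy⟩ := exists_quadratic_eq_zero h ⟨z, hz⟩
  let r : ℝ := (Real.sqrt (1 + ‖y‖ ^ 2))⁻¹
  have hr : r ^ 2 * (1 + ‖y‖ ^ 2) = 1 := by
    have : 0 < 1 + ‖y‖ ^ 2 := by positivity
    rw [inv_pow, Real.sq_sqrt this.le, inv_mul_cancel₀ this.ne']
  refine ⟨r, r * y, ?_, ?_⟩
  · have hy2 : star y * y = (‖y‖ : ℂ) ^ 2 := Complex.conj_mul' y
    have : (r : ℂ) ^ 2 * (1 + (‖y‖ : ℂ) ^ 2) = 1 := mod_cast hr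
    rw [← this, star_mul', ← hy2]
    simp only [Complex.star_def, Complex.conj_ofReal]
    ring
  · have : ((r : ℂ) • M₀ + ((r : ℂ) * y) • M₁).det = (r : ℂ) ^ 2 * 0 := by
      rw [← hy]
      simp [det_fin_two]
      ring
    simpa using this

/-- A three-qubit state is a sum of three product vectors which are orthogonal because either the
first factors are orthogonal, or both the second and the third factors are. -/
theorem exists_three_product_decomposition (φ : Fin 2 → Fin 2 → Fin 2 → ℂ) :
    ∃ a b c : Fin 3 → Fin 2 → ℂ, (∀ i j k, φ i j k = ∑ l, a l i * b l j * c l k) ∧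
      star (a 0) ⬝ᵥ a 1 = 0 ∧ star (a 0) ⬝ᵥ a 2 = 0 ∧
      (∀ l, star (b l) ⬝ᵥ b l = 1) ∧ star (b 1) ⬝ᵥ b 2 = 0 ∧
      (∀ l, star (c l) ⬝ᵥ c l = 1) ∧ star (c 1) ⬝ᵥ c 2 = 0 := by
  obtain ⟨x, y, hxy, hdet⟩ := exists_unit_det_pencil_eq_zero (of (φ 0)) (of (φ 1))
  set N₀ : Matrix (Fin 2) (Fin 2) ℂ := x • of (φ 0) + y • of (φ 1) with hN₀
  set N₁ : Matrix (Fin 2) (Fin 2) ℂ := -star y • of (φ 0) + star x • of (φ 1) with hN₁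
  obtain ⟨s, b₀, c₀, hb₀, hc₀, hs⟩ := exists_unit_vecMulVec_of_det_eq_zero hdet
  obtain ⟨U, hU, V, hV, d, hd⟩ := exists_unitary_mul_diagonal_mul_unitary N₁
  have hUU (i j) : star (U.col i) ⬝ᵥ U.col j = (1 : Matrix _ _ ℂ) i j :=
    star_col_dotProduct_col_of_mem_unitaryGroup hU i j
  have hVV (i j) : star (V.row i) ⬝ᵥ V.row j = (1 : Matrix _ _ ℂ) i j :=
    star_row_dotProduct_row_of_mem_unitaryGroup hV i j
  refine ⟨![s • ![star x, star y], d 0 • ![-y, x], d 1 • ![-y, x]], ![b₀, U.col 0, U.col 1],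
    ![c₀, V.row 0, V.row 1], ?_, ?_, ?_, ?_, ?_, ?_, ?_⟩
  · intro i j k
    have h₀ : N₀ j k = s * (b₀ j * c₀ k) := by rw [hs]; simp [vecMulVec_apply]
    have h₁ : N₁ j k = U j 0 * d 0 * V 0 k + U j 1 * d 1 * V 1 k := by
      rw [hd, mul_apply]; simp [mul_diagonal]
    have h : φ i j k = ![star x, star y] i * N₀ j k + ![-y, x] i * N₁ j k := by
      fin_cases i <;> simp [hN₀, hN₁] at hxy ⊢
      · linear_combination (-φ 0 j k) * hxy
      · linear_combination (-φ 1 j k) * hxy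
    rw [h, h₀, h₁]
    fin_cases i <;> simp [Fin.sum_univ_three] <;> ring
  · simp [dotProduct, Fin.sum_univ_two]; ring
  · simp [dotProduct, Fin.sum_univ_two]; ring
  · intro l; fin_cases l <;> simp [hb₀, hUU]
  · simp [hUU]
  · intro l; fin_cases l <;> simp [hc₀, hVV]
  · simp [hVV]

theorem sum_prod_mul_mul {ι κ μ R : Type*} [Fintype ι] [Fintype κ] [Fintype μ] [CommSemiring R]
    (f : ι → R) (g : κ → R) (h : μ → R) :
    ∑ x : ι × κ × μ, f x.1 * g x.2.1 * h x.2.2 = (∑ i, f i) * (∑ j, g j) * ∑ k, h k := by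
  simp only [Fintype.sum_prod_type, ← Finset.mul_sum, ← Finset.sum_mul]

theorem kron3_conjTranspose_mul_kron3_apply (A B C : Matrix (Fin 3) (Fin 3) ℂ)
    (p q : Fin 3 × Fin 3 × Fin 3) :
    ((kron3 A B C)ᴴ * kron3 A B C) p q =
      (Aᴴ * A) p.1 q.1 * (Bᴴ * B) p.2.1 q.2.1 * (Cᴴ * C) p.2.2 q.2.2 := by
  simp only [mul_apply, conjTranspose_apply, kron3, star_mul', ← sum_prod_mul_mul]
  exact Finset.sum_congr rfl fun x _ => by ring

theorem toEuclideanLin_kron3_GHZ3_apply (A B C : Matrix (Fin 3) (Fin 3) ℂ)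
    (p : Fin 3 × Fin 3 × Fin 3) :
    toEuclideanLin (kron3 A B C) GHZ3 p =
      (Real.sqrt 3 : ℂ)⁻¹ * ∑ j, A p.1 j * B p.2.1 j * C p.2.2 j := by
  simp [GHZ3, tp3, ket, kron3, toLpLin_apply, mulVec, dotProduct, Fintype.sum_prod_type,
    Fin.sum_univ_three]
  ring

/-- The matrix whose columns are the vectors `ε j • v j`, cyclically relabelled by `k`. -/
def signedColumns (ε : Fin 3 → ℤˣ) (v : Fin 3 → Fin 3 → ℂ) (k : Fin 3) :
    Matrix (Fin 3) (Fin 3) ℂ :=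
  of fun x j => (ε (j + k) : ℂ) * v (j + k) x

theorem signedColumns_conjTranspose_mul_self_apply (ε : Fin 3 → ℤˣ) (v : Fin 3 → Fin 3 → ℂ)
    (k i j : Fin 3) :
    ((signedColumns ε v k)ᴴ * signedColumns ε v k) i j =
      (ε (i + k) : ℂ) * (ε (j + k) : ℂ) * (star (v (i + k)) ⬝ᵥ v (j + k)) := by
  simp only [mul_apply, conjTranspose_apply, signedColumns, of_apply, dotProduct, Finset.mul_sum,
    star_mul', Pi.star_apply]
  refine Finset.sum_congr rfl fun x _ => ?_
  simp
  ring

theorem gram_symm_eq_zero {n : Type*} [Fintype n] {v w : n → ℂ} (h : star v ⬝ᵥ w = 0) :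
    star w ⬝ᵥ v = 0 := by
  rw [star_dotProduct, h, star_zero]

/-- The signs applied to the three product vectors by the three parties. Their product over the
parties is `1`, see `signPattern_mul`. -/
def signPattern (σ : ℤˣ × ℤˣ × ℤˣ) : Fin 3 → Fin 3 → ℤˣ :=
  ![![σ.1 * σ.2.1, 1, σ.2.2], ![σ.1, 1, σ.2.2], ![σ.2.1, 1, 1]]

theorem signPattern_mul (σ : ℤˣ × ℤˣ × ℤˣ) (j : Fin 3) :
    (signPattern σ 0 j : ℂ) * (signPattern σ 1 j : ℂ) * (signPattern σ 2 j : ℂ) = 1 := by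
  have h (s : ℤˣ) : (s : ℂ) * (s : ℂ) = 1 := by rcases Int.units_eq_one_or s with rfl | rfl <;> simp
  fin_cases j <;> simp [signPattern, h]
  linear_combination (σ.2.1 : ℂ) * (σ.2.1 : ℂ) * h σ.1 + h σ.2.1

/-- Averaging over the signs removes every coherence between the three product vectors. -/
theorem sum_signPattern_gram {a b c : Fin 3 → Fin 3 → ℂ}
    (ha₁ : star (a 0) ⬝ᵥ a 1 = 0) (ha₂ : star (a 0) ⬝ᵥ a 2 = 0)
    (hb : ∀ l, star (b l) ⬝ᵥ b l = 1) (hb' : star (b 1) ⬝ᵥ b 2 = 0)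
    (hc : ∀ l, star (c l) ⬝ᵥ c l = 1) (hc' : star (c 1) ⬝ᵥ c 2 = 0) (p q : Fin 3 × Fin 3 × Fin 3) :
    ∑ σ : ℤˣ × ℤˣ × ℤˣ,
      ((signPattern σ 0 p.1 : ℂ) * (signPattern σ 0 q.1 : ℂ) * (star (a p.1) ⬝ᵥ a q.1)) *
      ((signPattern σ 1 p.2.1 : ℂ) * (signPattern σ 1 q.2.1 : ℂ) * (star (b p.2.1) ⬝ᵥ b q.2.1)) *
      ((signPattern σ 2 p.2.2 : ℂ) * (signPattern σ 2 q.2.2 : ℂ) * (star (c p.2.2) ⬝ᵥ c q.2.2)) =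
      if p = q then 8 * (star (a p.1) ⬝ᵥ a p.1) else 0 := by
  have sq (s : ℤˣ) : (s : ℂ) * (s : ℂ) = 1 := by
    rcases Int.units_eq_one_or s with rfl | rfl <;> simp
  have hA (i j : Fin 3) : ∃ x : ℂ, ∀ σ : ℤˣ × ℤˣ × ℤˣ,
      (signPattern σ 0 i : ℂ) * (signPattern σ 0 j : ℂ) * (star (a i) ⬝ᵥ a j) =
        (if i = j then star (a i) ⬝ᵥ a i else 0) + σ.2.2 * x := by
    refine ⟨if i = j then 0 else star (a i) ⬝ᵥ a j, fun σ => ?_⟩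
    fin_cases i <;> fin_cases j <;>
      simp [signPattern, ha₁, ha₂, gram_symm_eq_zero ha₁, gram_symm_eq_zero ha₂, sq, mul_mul_mul_comm]
  have hB (i j : Fin 3) : ∃ x y : ℂ, ∀ σ : ℤˣ × ℤˣ × ℤˣ,
      (signPattern σ 1 i : ℂ) * (signPattern σ 1 j : ℂ) * (star (b i) ⬝ᵥ b j) =
        (if i = j then 1 else 0) + σ.1 * x + σ.1 * σ.2.2 * y := by
    refine ⟨if i + j = 1 ∧ i ≠ j then star (b i) ⬝ᵥ b j else 0,
      if i + j = 2 ∧ i ≠ j then star (b i) ⬝ᵥ b j else 0, fun σ => ?_⟩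
    fin_cases i <;> fin_cases j <;>
      simp [signPattern, hb, hb', gram_symm_eq_zero hb', sq, mul_comm]
  have hC (i j : Fin 3) : ∃ x : ℂ, ∀ σ : ℤˣ × ℤˣ × ℤˣ,
      (signPattern σ 2 i : ℂ) * (signPattern σ 2 j : ℂ) * (star (c i) ⬝ᵥ c j) =
        (if i = j then 1 else 0) + σ.2.1 * x := by
    refine ⟨if i = j then 0 else star (c i) ⬝ᵥ c j, fun σ => ?_⟩
    fin_cases i <;> fin_cases j <;> simp [signPattern, hc, hc', gram_symm_eq_zero hc', sq]
  obtain ⟨x, hA⟩ := hA p.1 q.1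
  obtain ⟨y, z, hB⟩ := hB p.2.1 q.2.1
  obtain ⟨w, hC⟩ := hC p.2.2 q.2.2
  have hpq : (if p = q then 8 * (star (a p.1) ⬝ᵥ a p.1) else 0) =
      8 * (if p.1 = q.1 then star (a p.1) ⬝ᵥ a p.1 else 0) * (if p.2.1 = q.2.1 then 1 else 0) *
        (if p.2.2 = q.2.2 then 1 else 0) := by
    simp only [Prod.ext_iff]
    split_ifs <;> simp_all
  simp_rw [hA, hB, hC, hpq]
  generalize (if p.1 = q.1 then star (a p.1) ⬝ᵥ a p.1 else 0) = x₀
  generalize (if p.2.1 = q.2.1 then (1 : ℂ) else 0) = y₀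
  generalize (if p.2.2 = q.2.2 then (1 : ℂ) else 0) = w₀
  simp [Fintype.sum_prod_type, UnitsInt.univ]
  ring

/-- A sum of three product vectors `a l ⊗ b l ⊗ c l` as in `exists_three_product_decomposition` is
the output of every branch of a complete product family applied to the GHZ state. -/
theorem exists_complete_product_family {a b c : Fin 3 → Fin 3 → ℂ}
    {ψ : EuclideanSpace ℂ (Fin 3 × Fin 3 × Fin 3)}
    (hψ : ∀ p, ψ p = ∑ l, a l p.1 * b l p.2.1 * c l p.2.2)
    (ha : ∑ l, star (a l) ⬝ᵥ a l = 1)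
    (ha₁ : star (a 0) ⬝ᵥ a 1 = 0) (ha₂ : star (a 0) ⬝ᵥ a 2 = 0)
    (hb : ∀ l, star (b l) ⬝ᵥ b l = 1) (hb' : star (b 1) ⬝ᵥ b 2 = 0)
    (hc : ∀ l, star (c l) ⬝ᵥ c l = 1) (hc' : star (c 1) ⬝ᵥ c 2 = 0) :
    ∃ (m : ℕ) (A B C : Fin m → Matrix (Fin 3) (Fin 3) ℂ),
      (∑ i, (kron3 (A i) (B i) (C i))ᴴ * kron3 (A i) (B i) (C i) = 1)
      ∧ ∀ i, ∃ c : ℂ, toEuclideanLin (kron3 (A i) (B i) (C i)) GHZ3 = c • ψ := by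
  let r : ℂ := (Real.sqrt 8 : ℂ)⁻¹
  have hr : star r * r = 8⁻¹ := by
    have : (Real.sqrt 8 : ℂ) * (Real.sqrt 8 : ℂ) = 8 := by
      rw [← Complex.ofReal_mul, Real.mul_self_sqrt (by norm_num)]; norm_num
    simp [r, ← mul_inv, this]
  let ι := Fin 3 × ℤˣ × ℤˣ × ℤˣ
  let A (τ : ι) := r • signedColumns (signPattern τ.2 0) a τ.1
  let B (τ : ι) := signedColumns (signPattern τ.2 1) b τ.1
  let C (τ : ι) := signedColumns (signPattern τ.2 2) c τ.1
  let e : Fin (Fintype.card ι) ≃ ι := (Fintype.equivFin ι).symm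
  refine ⟨Fintype.card ι, A ∘ e, B ∘ e, C ∘ e, ?_, fun i => ?_⟩
  · refine (e.sum_comp fun τ => (kron3 (A τ) (B τ) (C τ))ᴴ * kron3 (A τ) (B τ) (C τ)).trans ?_
    ext p q
    have hτ (τ : ι) : ((kron3 (A τ) (B τ) (C τ))ᴴ * kron3 (A τ) (B τ) (C τ)) p q = 8⁻¹ * _ :=
      (kron3_conjTranspose_mul_kron3_apply _ _ _ p q).trans <| by
        simp only [A, B, C, conjTranspose_smul, Matrix.smul_mul, Matrix.mul_smul,
          Matrix.smul_apply, signedColumns_conjTranspose_mul_self_apply, smul_eq_mul]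
        rw [← mul_assoc r, mul_comm r, hr, mul_assoc (8⁻¹ : ℂ), mul_assoc (8⁻¹ : ℂ)]
    have hshift (k : Fin 3) := sum_signPattern_gram ha₁ ha₂ hb hb' hc hc'
      (p.1 + k, p.2.1 + k, p.2.2 + k) (q.1 + k, q.2.1 + k, q.2.2 + k)
    rw [Matrix.sum_apply, Fintype.sum_prod_type]
    simp only [hτ, ← Finset.mul_sum, hshift]
    rw [one_apply]
    split_ifs with h
    · subst h
      have := Equiv.sum_comp (Equiv.addLeft p.1) fun l => star (a l) ⬝ᵥ a l
      simp only [Equiv.coe_addLeft] at this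
      simp [← Finset.mul_sum, this, ha]
    · have (k : Fin 3) : (p.1 + k, p.2.1 + k, p.2.2 + k) ≠ (q.1 + k, q.2.1 + k, q.2.2 + k) := by
        simpa [Prod.ext_iff] using h
      simp [this]
  · refine ⟨(Real.sqrt 3 : ℂ)⁻¹ * r, ?_⟩
    ext p
    rw [toEuclideanLin_kron3_GHZ3_apply, PiLp.smul_apply, smul_eq_mul, hψ, mul_assoc,
      ← Equiv.sum_comp (Equiv.addRight (e i).1) fun l => a l p.1 * b l p.2.1 * c l p.2.2, Finset.mul_sum _ _ r]
    refine congrArg _ (Finset.sum_congr rfl fun j _ => ?_)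
    have := signPattern_mul (e i).2 (j + (e i).1)
    simp only [Function.comp_apply, A, B, C, Matrix.smul_apply, signedColumns, of_apply, smul_eq_mul,
      Equiv.coe_addRight]
    linear_combination (r * a (j + (e i).1) p.1 * b (j + (e i).1) p.2.1 *
      c (j + (e i).1) p.2.2) * this

theorem sum_star_mul_self_eq_one {n : Type*} [Fintype n] {ψ : EuclideanSpace ℂ n} (h : ‖ψ‖ = 1) :
    ∑ p, star (ψ p) * ψ p = 1 := by
  have := inner_self_eq_norm_sq_to_K (𝕜 := ℂ) ψ
  rw [PiLp.inner_apply, h] at this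
  simpa [Complex.conj_mul'] using this

/-- The weights of an orthogonal decomposition of a unit vector into product vectors add up to
one. -/
theorem sum_weights_eq_one {a b c : Fin 3 → Fin 3 → ℂ}
    {ψ : EuclideanSpace ℂ (Fin 3 × Fin 3 × Fin 3)} (hψn : ‖ψ‖ = 1)
    (hψ : ∀ p, ψ p = ∑ l, a l p.1 * b l p.2.1 * c l p.2.2)
    (ha₁ : star (a 0) ⬝ᵥ a 1 = 0) (ha₂ : star (a 0) ⬝ᵥ a 2 = 0)
    (hb : ∀ l, star (b l) ⬝ᵥ b l = 1) (hb' : star (b 1) ⬝ᵥ b 2 = 0)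
    (hc : ∀ l, star (c l) ⬝ᵥ c l = 1) :
    ∑ l, star (a l) ⬝ᵥ a l = 1 := by
  have key : ∑ p, star (ψ p) * ψ p = ∑ l, ∑ m,
      (star (a l) ⬝ᵥ a m) * (star (b l) ⬝ᵥ b m) * (star (c l) ⬝ᵥ c m) := by
    simp only [hψ, star_sum, Finset.sum_mul_sum]
    rw [Finset.sum_comm]
    refine Finset.sum_congr rfl fun l _ => ?_
    rw [Finset.sum_comm]
    refine Finset.sum_congr rfl fun m _ => ?_
    simp only [dotProduct, ← sum_prod_mul_mul, star_mul', Pi.star_apply]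
    exact Finset.sum_congr rfl fun x _ => by ring
  rw [sum_star_mul_self_eq_one hψn] at key
  simpa [Fin.sum_univ_three, ha₁, ha₂, gram_symm_eq_zero ha₁, gram_symm_eq_zero ha₂, hb, hb',
    gram_symm_eq_zero hb', hc] using key.symm

/-- The inclusion of a qubit into `ℂ³`. -/
def qubitToQutrit (v : Fin 2 → ℂ) : Fin 3 → ℂ := ![v 0, v 1, 0]

theorem star_qubitToQutrit_dotProduct (v w : Fin 2 → ℂ) :
    star (qubitToQutrit v) ⬝ᵥ qubitToQutrit w = star v ⬝ᵥ w := by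
  simp [qubitToQutrit, dotProduct, Fin.sum_univ_three, Fin.sum_univ_two]

/-- **Corollary 1.** Every tripartite pure three-qubit state — i.e. every unit vector of
`ℂ³⊗ℂ³⊗ℂ³` supported on the basis vectors `|xyz⟩` with `x, y, z ∈ {0,1}` — can be
obtained from `|GHZ₃⟩ = (|000⟩+|111⟩+|222⟩)/√3` by LOCC with probability 1: there is a
complete product family every branch of which outputs a scalar multiple of the target. -/
theorem ghz3_to_any_three_qubit_state_probability_one
    (ψ : EuclideanSpace ℂ (Fin 3 × Fin 3 × Fin 3)) (hψn : ‖ψ‖ = 1)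
    (hsupp : ∀ p : Fin 3 × Fin 3 × Fin 3, (p.1 = 2 ∨ p.2.1 = 2 ∨ p.2.2 = 2) → ψ p = 0) :
    ∃ (m : ℕ) (A B C : Fin m → Matrix (Fin 3) (Fin 3) ℂ),
      (∑ i, (kron3 (A i) (B i) (C i))ᴴ * kron3 (A i) (B i) (C i) = 1)
      ∧ ∀ i, ∃ c : ℂ, Matrix.toEuclideanLin (kron3 (A i) (B i) (C i)) GHZ3 = c • ψ := by
  obtain ⟨a, b, c, hφ, ha₁, ha₂, hb, hb', hc, hc'⟩ := exists_three_product_decomposition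
    fun i j k => ψ (i.castSucc, j.castSucc, k.castSucc)
  simp only [← star_qubitToQutrit_dotProduct] at ha₁ ha₂ hb hb' hc hc'
  have hψ (p) : ψ p = ∑ l, qubitToQutrit (a l) p.1 * qubitToQutrit (b l) p.2.1 *
      qubitToQutrit (c l) p.2.2 := by
    obtain ⟨i, j, k⟩ := p
    induction i using Fin.lastCases with
    | last => simpa [qubitToQutrit, Fin.last] using hsupp (2, j, k) (.inl rfl)
    | cast i =>
      induction j using Fin.lastCases with
      | last => simpa [qubitToQutrit, Fin.last] using hsupp (i.castSucc, 2, k) (.inr (.inl rfl))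
      | cast j =>
        induction k using Fin.lastCases with
        | last =>
          simpa [qubitToQutrit, Fin.last] using
            hsupp (i.castSucc, j.castSucc, 2) (.inr (.inr rfl))
        | cast k =>
          have (v : Fin 2 → ℂ) (x : Fin 2) : qubitToQutrit v x.castSucc = v x := by
            fin_cases x <;> rfl
          simp only [this]
          exact hφ i j k
  exact exists_complete_product_family hψ (sum_weights_eq_one hψn hψ ha₁ ha₂ hb hb' hc) ha₁ ha₂ hb
    hb' hc hc'
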